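/- Let q be an odd prime, n ≥ 1 and s ≥ 1 integers, and d ∈ (ZMod (q^n))ˣ. For every w ∈ (ZMod (q^n))ˣ the element 1 − q^(2s)·w²·d is a unit; define δ(w) = w²·(1 − q^(2s)·w²·d)⁻¹. Then: (a) for units w, w′ one has δ(w) = δ(w′) if and only if w′ = w or w′ = −w; (b) the image of δ equals {y ∈ (ZMod (q^n))ˣ : the image of y in ZMod q is a square in (ZMod q)ˣ}. -/

import Mathlib

theorem aux_ker (q n : ℕ) [Fact q.Prime] (h : q ∣ q ^ n) (x : ZMod (q ^ n))
    (hx : ZMod.castHom h (ZMod q) x = 0) : (q : ZMod (q ^ n)) ∣ x := by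
  have : NeZero (q ^ n) := ⟨pow_ne_zero _ (Fact.out : q.Prime).ne_zero⟩
  rw [← ZMod.natCast_zmod_val x, map_natCast, ZMod.natCast_eq_zero_iff] at hx
  rw [← ZMod.natCast_zmod_val x]
  exact Nat.cast_dvd_cast hx

theorem aux_unit (q n : ℕ) [Fact q.Prime] (h : q ∣ q ^ n) (x : ZMod (q ^ n)) :
    IsUnit x ↔ ZMod.castHom h (ZMod q) x ≠ 0 := by
  have : NeZero (q ^ n) := ⟨pow_ne_zero _ (Fact.out : q.Prime).ne_zero⟩
  constructor
  · intro hx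
    exact (hx.map (ZMod.castHom h (ZMod q))).ne_zero
  · intro hx
    rw [← ZMod.natCast_zmod_val x, map_natCast, Ne, ZMod.natCast_eq_zero_iff] at hx
    rw [← ZMod.natCast_zmod_val x, ZMod.isUnit_iff_coprime]
    exact (((Fact.out : q.Prime).coprime_iff_not_dvd.2 hx).symm).pow_right n

theorem aux_sq (q n : ℕ) [Fact q.Prime] (hq : Odd q) (h : q ∣ q ^ n) (y : ZMod (q ^ n))
    (z : ZMod q) (hz : z ≠ 0) (hy : ZMod.castHom h (ZMod q) y = z ^ 2) :
    ∃ w, IsUnit w ∧ w ^ 2 = y := by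
  obtain ⟨t, rfl⟩ := ZMod.castHom_surjective h z
  obtain ⟨t, rfl⟩ := (aux_unit q n h t).2 hz
  set u : ZMod (q ^ n) := y * (↑t⁻¹) ^ 2 with hu
  have hyu : y = t ^ 2 * u := by
    rw [hu, mul_left_comm, ← mul_pow, Units.mul_inv]; simp
  have hu1 : ZMod.castHom h (ZMod q) (u - 1) = 0 := by
    rw [hyu, map_mul, map_pow] at hy
    have := mul_left_cancel₀ (pow_ne_zero 2 hz) (hy.trans (mul_one _).symm)
    rw [map_sub, this, map_one, sub_self]
  have hd := dvd_sub_pow_of_dvd_sub (aux_ker q n h _ hu1) n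
  have h0 : (q : ZMod (q ^ n)) ^ (n + 1) = 0 := by
    rw [pow_succ, ← Nat.cast_pow, ZMod.natCast_self, zero_mul]
  rw [h0, zero_dvd_iff, one_pow, sub_eq_zero] at hd
  obtain ⟨k, hk⟩ := (hq.pow : Odd (q ^ n))
  have huu : u ^ (2 * k + 1) = 1 := by rw [← hk, hd]
  refine ⟨t * u ^ (k + 1), t.isUnit.mul (IsUnit.pow _ ?_), ?_⟩
  · exact IsUnit.of_mul_eq_one (u ^ (2 * k)) (by rw [← huu]; ring)
  · rw [hyu]
    calc _ = t ^ 2 * (u ^ (2 * k + 1) * u) := by ring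
      _ = _ := by rw [huu, one_mul]

theorem stmt17 (q n s : ℕ) [Fact q.Prime] (hq : Odd q) (hn : 1 ≤ n) (hs : 1 ≤ s)
    (d : (ZMod (q ^ n))ˣ)
    (δ : ZMod (q ^ n) → ZMod (q ^ n))
    (hδ : ∀ x : ZMod (q ^ n), δ x =
      x ^ 2 * (1 - (q : ZMod (q ^ n)) ^ (2 * s) * x ^ 2 * (d : ZMod (q ^ n)))⁻¹) :
    (∀ w : (ZMod (q ^ n))ˣ,
      IsUnit (1 - (q : ZMod (q ^ n)) ^ (2 * s) * (w : ZMod (q ^ n)) ^ 2 *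
        (d : ZMod (q ^ n)))) ∧
    (∀ w w' : (ZMod (q ^ n))ˣ,
      δ (w : ZMod (q ^ n)) = δ (w' : ZMod (q ^ n)) ↔ w' = w ∨ w' = -w) ∧
    δ '' {x : ZMod (q ^ n) | IsUnit x} =
      {y : ZMod (q ^ n) | IsUnit y ∧ ∃ z : (ZMod q)ˣ,
        ZMod.castHom (dvd_pow_self q (by omega : n ≠ 0)) (ZMod q) y = (z : ZMod q) ^ 2} := by
  have h := dvd_pow_self q (by omega : n ≠ 0)
  have hφq : ∀ a : ZMod (q ^ n),
      ZMod.castHom h (ZMod q) ((q : ZMod (q ^ n)) ^ (2 * s) * a) = 0 := by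
    intro a
    rw [map_mul, map_pow, map_natCast, ZMod.natCast_self, zero_pow (by omega), zero_mul]
  have hU : ∀ a : ZMod (q ^ n), IsUnit (1 - (q : ZMod (q ^ n)) ^ (2 * s) * a ^ 2 * d) := by
    intro a
    rw [aux_unit q n h, mul_assoc, map_sub, hφq, map_one, sub_zero]
    exact one_ne_zero
  have key : ∀ a y : ZMod (q ^ n), δ a = y ↔
      a ^ 2 = y * (1 - (q : ZMod (q ^ n)) ^ (2 * s) * a ^ 2 * d) := by
    intro a y
    rw [hδ]
    have h1 := ZMod.mul_inv_of_unit _ (hU a)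
    constructor
    · rintro rfl
      rw [mul_assoc, mul_comm (_⁻¹), h1, mul_one]
    · intro e
      conv_lhs => rw [e]
      rw [← e, e, mul_assoc, ← e, h1, mul_one]
  refine ⟨fun w => hU w, ?_, ?_⟩
  · intro w w'
    constructor
    · intro e
      have e1 := (key w _).1 e
      have e2 := (key w' _).1 rfl
      have e3 : ((w : ZMod (q ^ n)) - w') * (w + w') = 0 := by
        generalize δ (w' : ZMod (q ^ n)) = y at e1 e2
        have hv : IsUnit (1 + (q : ZMod (q ^ n)) ^ (2 * s) * (y * d)) := by
          rw [aux_unit q n h, map_add, hφq, map_one, add_zero]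
          exact one_ne_zero
        apply hv.mul_left_cancel
        linear_combination e1 - e2
      by_cases hc : IsUnit ((w : ZMod (q ^ n)) - w')
      · right
        have := hc.mul_left_cancel (e3.trans (mul_zero _).symm)
        ext
        rw [Units.val_neg]
        linear_combination this
      · left
        have hc2 : IsUnit ((w : ZMod (q ^ n)) + w') := by
          rw [aux_unit q n h, not_not, map_sub] at hc
          rw [aux_unit q n h, map_add, ← sub_eq_zero.1 hc, ← two_mul]
          refine mul_ne_zero ?_ ((aux_unit q n h _).1 w.isUnit)
          have : Fact (2 < q) := ⟨by
            have := (Fact.out : q.Prime).two_le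
            obtain ⟨k, hk⟩ := hq
            omega⟩
          exact Ring.two_ne_zero (by rw [ZMod.ringChar_zmod_n]; exact this.out.ne')
        have := hc2.mul_right_cancel (e3.trans (zero_mul _).symm)
        ext
        linear_combination -this
    · rintro (rfl | rfl)
      · rfl
      · rw [hδ, hδ, Units.val_neg, neg_sq]
  · ext y
    constructor
    · rintro ⟨x, hx, e⟩
      have hx : IsUnit x := hx
      have e1 := (key x y).1 e
      have hx0 := (aux_unit q n h x).1 hx
      have e2 : ZMod.castHom h (ZMod q) y = (ZMod.castHom h (ZMod q) x) ^ 2 := by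
        have := congrArg (ZMod.castHom h (ZMod q)) e1
        rw [mul_assoc, map_mul, map_sub, hφq, map_one, sub_zero, mul_one, map_pow] at this
        exact this.symm
      refine ⟨?_, Units.mk0 _ hx0, e2⟩
      rw [aux_unit q n h, e2]
      exact pow_ne_zero 2 hx0
    · rintro ⟨hy, z, hz⟩
      have hv : IsUnit (1 + (q : ZMod (q ^ n)) ^ (2 * s) * (y * d)) := by
        rw [aux_unit q n h, map_add, hφq, map_one, add_zero]
        exact one_ne_zero
      obtain ⟨v, hv⟩ := hv
      have hvi : ZMod.castHom h (ZMod q) (y * ↑v⁻¹) = (z : ZMod q) ^ 2 := by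
        have h1 : ZMod.castHom h (ZMod q) (v : ZMod (q ^ n)) = 1 := by
          rw [hv, map_add, hφq, map_one, add_zero]
        have h2 := congrArg (ZMod.castHom h (ZMod q)) v.mul_inv
        rw [map_mul, h1, one_mul, map_one] at h2
        rw [map_mul, h2, mul_one]
        exact hz
      obtain ⟨w, hw, e⟩ := aux_sq q n hq h _ _ z.ne_zero hvi
      refine ⟨w, hw, (key w y).2 ?_⟩
      have e3 : w ^ 2 * v = y := by rw [e, mul_assoc, Units.inv_mul, mul_one]
      rw [hv] at e3
      linear_combination e3
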